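/- Let f, g ∈ Hˢ(𝕋ⁿ) ∩ L^∞(𝕋ⁿ) with s ≥ 0. Then the product fg belongs to Hˢ(𝕋ⁿ) and ‖fg‖_{Hˢ} ≤ C(‖f‖_{Hˢ}‖g‖_{L^∞} + ‖f‖_{L^∞}‖g‖_{Hˢ}) for a constant C depending only on s and n. -/

import Mathlib

open MeasureTheory Complex

/-- Fundamental domain of the `n`-torus. -/
def unitBox (n : ℕ) : Set (Fin n → ℝ) := Set.pi Set.univ fun _ => Set.Ico (0 : ℝ) 1

/-- The `k`-th Fourier coefficient of a function on the `n`-torus. -/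
noncomputable def fCoeff {n : ℕ} (f : (Fin n → ℝ) → ℂ) (k : Fin n → ℤ) : ℂ :=
  ∫ x in unitBox n, f x * Complex.exp (-(2 * Real.pi * Complex.I) * ∑ i, (k i : ℂ) * (x i : ℂ))

/-- Squared `Hˢ` Sobolev norm of a function on the `n`-torus, via Fourier coefficients. -/
noncomputable def hSobSq {n : ℕ} (s : ℝ) (f : (Fin n → ℝ) → ℂ) : ℝ :=
  ∑' k : Fin n → ℤ, (1 + ∑ i, ((k i : ℝ)) ^ 2) ^ s * ‖fCoeff f k‖ ^ 2

/-- `Hˢ` Sobolev norm on the `n`-torus. -/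
noncomputable def hSob {n : ℕ} (s : ℝ) (f : (Fin n → ℝ) → ℂ) : ℝ :=
  Real.sqrt (hSobSq s f)

/-- Membership in `Hˢ(𝕋ⁿ)`: the weighted Fourier series is square-summable. -/
def MemHs {n : ℕ} (s : ℝ) (f : (Fin n → ℝ) → ℂ) : Prop :=
  Summable (fun k : Fin n → ℤ => (1 + ∑ i, ((k i : ℝ)) ^ 2) ^ s * ‖fCoeff f k‖ ^ 2)

/-- The character `x ↦ exp (2πi k·x)` of the torus, as a function on `ℝⁿ`. -/
noncomputable def torusChar {n : ℕ} (k : Fin n → ℤ) (x : Fin n → ℝ) : ℂ :=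
  exp (2 * Real.pi * I * ∑ i, (k i : ℂ) * (x i : ℂ))

/-- Lebesgue measure on the fundamental domain of the torus. -/
noncomputable abbrev boxMeasure (n : ℕ) : Measure (Fin n → ℝ) := volume.restrict (unitBox n)

lemma torusChar_add {n : ℕ} (k l : Fin n → ℤ) (x : Fin n → ℝ) :
    torusChar (k + l) x = torusChar k x * torusChar l x := by
  simp only [torusChar, ← exp_add, ← mul_add, ← Finset.sum_add_distrib, Pi.add_apply]
  push_cast
  simp only [add_mul]

lemma torusChar_sub_arg {n : ℕ} (k : Fin n → ℤ) (x y : Fin n → ℝ) :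
    torusChar k (x - y) = torusChar k x * torusChar (-k) y := by
  simp only [torusChar, ← exp_add, ← mul_add, ← Finset.sum_add_distrib, Pi.neg_apply, Pi.sub_apply]
  push_cast
  congr 2
  exact Finset.sum_congr rfl fun i _ => by ring

lemma norm_torusChar {n : ℕ} (k : Fin n → ℤ) (x : Fin n → ℝ) : ‖torusChar k x‖ = 1 := by
  have : torusChar k x = exp (((2 * Real.pi * ∑ i, (k i : ℝ) * x i : ℝ) : ℂ) * I) := by
    simp only [torusChar]
    push_cast
    ring_nf
  rw [this, norm_exp_ofReal_mul_I]

lemma continuous_torusChar {n : ℕ} (k : Fin n → ℤ) : Continuous (torusChar k) := by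
  unfold torusChar
  fun_prop

lemma fCoeff_eq {n : ℕ} (f : (Fin n → ℝ) → ℂ) (k : Fin n → ℤ) :
    fCoeff f k = ∫ x, f x * torusChar (-k) x ∂boxMeasure n := by
  simp only [fCoeff, torusChar, Pi.neg_apply]
  congr! 4
  push_cast
  simp only [neg_mul, Finset.sum_neg_distrib, mul_neg]

instance isProbabilityMeasure_boxMeasure (n : ℕ) : IsProbabilityMeasure (boxMeasure n) where
  measure_univ := by simp [unitBox, Real.volume_pi_Ico]

section Transfer

noncomputable local instance : MeasureSpace UnitAddCircle := ⟨AddCircle.haarAddCircle⟩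

local instance : Measure.IsAddHaarMeasure (volume : Measure UnitAddCircle) :=
  inferInstanceAs (Measure.IsAddHaarMeasure AddCircle.haarAddCircle)

local instance : IsProbabilityMeasure (volume : Measure UnitAddCircle) :=
  inferInstanceAs (IsProbabilityMeasure AddCircle.haarAddCircle)

/-- The representative of a point of the torus in the box `(0, 1]ⁿ`. -/
noncomputable def torusRep (n : ℕ) (z : UnitAddTorus (Fin n)) : Fin n → ℝ :=
  (UnitAddTorus.measurableEquivPiIoc (fun _ : Fin n => (0 : ℝ)) z).1

lemma measurePreserving_torusRep (n : ℕ) :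
    MeasurePreserving (torusRep n) volume (boxMeasure n) := by
  have h1 := UnitAddTorus.measurePreserving_equivPiIoc (fun _ : Fin n => (0 : ℝ))
  have hm : MeasurableSet {x : Fin n → ℝ | ∀ i, x i ∈ Set.Ioc (0 : ℝ) (0 + 1)} :=
    MeasurableSet.univ_pi' fun i => measurableSet_Ioc
  have h2 := (measurePreserving_subtype_coe (μa := (volume : Measure (Fin n → ℝ))) hm).comp h1
  have hb : boxMeasure n =
      volume.restrict {x : Fin n → ℝ | ∀ i, x i ∈ Set.Ioc (0 : ℝ) (0 + 1)} := by
    refine Measure.restrict_congr_set ?_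
    have h3 := (Measure.univ_pi_Ico_ae_eq_Icc (μ := fun _ : Fin n => (volume : Measure ℝ))
      (f := fun _ => 0) (g := fun _ => 1)).trans
      (Measure.univ_pi_Ioc_ae_eq_Icc (μ := fun _ : Fin n => (volume : Measure ℝ))
      (f := fun _ => 0) (g := fun _ => 1)).symm
    rw [volume_pi]
    have hIoc : {x : Fin n → ℝ | ∀ i, x i ∈ Set.Ioc (0 : ℝ) (0 + 1)} =
        Set.pi Set.univ fun _ => Set.Ioc 0 1 := by
      ext x
      simp
    rw [hIoc]
    exact h3
  rw [hb]
  exact h2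

lemma mFourier_eq_torusChar {n : ℕ} (k : Fin n → ℤ) (z : UnitAddTorus (Fin n)) :
    UnitAddTorus.mFourier k z = torusChar k (torusRep n z) := by
  have hz : z = fun i => ((torusRep n z i : ℝ) : UnitAddCircle) :=
    ((UnitAddTorus.measurableEquivPiIoc (fun _ : Fin n => (0 : ℝ))).symm_apply_apply z).symm
  conv_lhs => rw [hz]
  simp only [UnitAddTorus.mFourier, ContinuousMap.coe_mk, fourier_coe_apply, torusChar,
    Finset.mul_sum, exp_sum]
  refine Finset.prod_congr rfl fun i _ => ?_
  congr 1
  push_cast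
  ring

lemma fCoeff_eq_mFourierCoeff {n : ℕ} {f : (Fin n → ℝ) → ℂ}
    (hf : AEStronglyMeasurable f (boxMeasure n)) (k : Fin n → ℤ) :
    fCoeff f k = UnitAddTorus.mFourierCoeff (f ∘ torusRep n) k := by
  have hr := measurePreserving_torusRep n
  rw [fCoeff_eq, UnitAddTorus.mFourierCoeff, ← hr.map_eq, integral_map hr.aemeasurable]
  · simp only [mFourier_eq_torusChar, Function.comp_apply, smul_eq_mul, mul_comm]
  · rw [hr.map_eq]
    exact hf.mul (continuous_torusChar _).aestronglyMeasurable

lemma tsum_enorm_fCoeff_sq {n : ℕ} {f : (Fin n → ℝ) → ℂ} (hf : MemLp f 2 (boxMeasure n)) :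
    ∑' k, ‖fCoeff f k‖ₑ ^ 2 = ∫⁻ x, ‖f x‖ₑ ^ 2 ∂boxMeasure n := by
  have hr := measurePreserving_torusRep n
  have hF : MemLp (f ∘ torusRep n) 2 volume := hf.comp_measurePreserving hr
  have hae := hF.coeFn_toLp
  have hs := UnitAddTorus.hasSum_sq_mFourierCoeff hF.toLp
  have hc : ∀ k, UnitAddTorus.mFourierCoeff (hF.toLp) k = fCoeff f k := fun k => by
    rw [fCoeff_eq_mFourierCoeff hf.1]
    refine integral_congr_ae ?_
    filter_upwards [hae] with z hz
    rw [hz]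
  simp only [hc] at hs
  have hi : ∫ t, ‖(hF.toLp : UnitAddTorus (Fin n) → ℂ) t‖ ^ 2 = ∫ x, ‖f x‖ ^ 2 ∂boxMeasure n := by
    rw [← hr.map_eq, integral_map hr.aemeasurable]
    · refine integral_congr_ae ?_
      filter_upwards [hae] with z hz
      rw [hz, Function.comp_apply]
    · rw [hr.map_eq]
      exact hf.1.norm.pow 2
  rw [hi] at hs
  have h1 : ∀ z : ℂ, ‖z‖ₑ ^ 2 = ENNReal.ofReal (‖z‖ ^ 2) := fun z => by
    rw [ENNReal.ofReal_pow (norm_nonneg _), ofReal_norm]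
  simp only [h1]
  rw [← ENNReal.ofReal_tsum_of_nonneg (fun _ => by positivity) hs.summable, hs.tsum_eq,
    ofReal_integral_eq_lintegral_ofReal hf.norm.integrable_sq (ae_of_all _ fun _ => by positivity)]

lemma fCoeff_torusChar {n : ℕ} (k l : Fin n → ℤ) :
    fCoeff (torusChar k) l = if k = l then 1 else 0 := by
  rw [fCoeff_eq_mFourierCoeff (continuous_torusChar k).aestronglyMeasurable]
  have h := orthonormal_iff_ite.mp (UnitAddTorus.orthonormal_mFourier (d := Fin n)) l k
  simp only [ContinuousMap.inner_toLp, ← UnitAddTorus.mFourier_neg] at h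
  simp only [eq_comm (a := k), ← h, UnitAddTorus.mFourierCoeff, smul_eq_mul, Function.comp_apply,
    mFourier_eq_torusChar, mul_comm]

end Transfer

section Cubes

variable {n : ℕ}

/-- The frequencies `k ∈ ℤⁿ` with `|kᵢ| ≤ a` for every `i`. -/
noncomputable def freqCube (n a : ℕ) : Finset (Fin n → ℤ) := Fintype.piFinset fun _ => Finset.Icc (-(a : ℤ)) a

lemma mem_freqCube {a : ℕ} {k : Fin n → ℤ} : k ∈ freqCube n a ↔ ∀ i, |k i| ≤ a := by
  simp [freqCube, abs_le]

lemma add_mem_freqCube {a b : ℕ} {k l : Fin n → ℤ} (hk : k ∈ freqCube n a)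
    (hl : l ∈ freqCube n b) : k + l ∈ freqCube n (a + b) := by
  rw [mem_freqCube] at *
  intro i
  push_cast
  exact (abs_add_le _ _).trans (add_le_add (hk i) (hl i))

lemma neg_mem_freqCube {a : ℕ} {k : Fin n → ℤ} (hk : k ∈ freqCube n a) : -k ∈ freqCube n a := by
  simpa [mem_freqCube] using hk

lemma card_freqCube (a : ℕ) : (freqCube n a).card = (2 * a + 1) ^ n := by
  simp only [freqCube, Fintype.card_piFinset, Int.card_Icc, Finset.prod_const, Finset.card_univ,
    Fintype.card_fin]
  congr 1
  omega

lemma card_freqCube_two_mul_le (a : ℕ) :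
    (freqCube n (2 * a)).card ≤ 2 ^ n * (freqCube n a).card := by
  rw [card_freqCube, card_freqCube, ← mul_pow]
  exact Nat.pow_le_pow_left (by omega) n

end Cubes

section TrigPoly

variable {n : ℕ}

lemma norm_mul_torusChar (z : ℂ) (k : Fin n → ℤ) (x : Fin n → ℝ) :
    ‖z * torusChar k x‖ = ‖z‖ := by rw [norm_mul, norm_torusChar, mul_one]

lemma integrable_mul_torusChar {f : (Fin n → ℝ) → ℂ} (hf : Integrable f (boxMeasure n))
    (k : Fin n → ℤ) : Integrable (fun x => f x * torusChar k x) (boxMeasure n) :=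
  hf.mul_bdd (c := 1) (continuous_torusChar k).aestronglyMeasurable
    (ae_of_all _ fun x => (norm_torusChar k x).le)

lemma fCoeff_sub {f g : (Fin n → ℝ) → ℂ} (hf : Integrable f (boxMeasure n))
    (hg : Integrable g (boxMeasure n)) (k : Fin n → ℤ) :
    fCoeff (fun x => f x - g x) k = fCoeff f k - fCoeff g k := by
  simp only [fCoeff_eq, sub_mul]
  exact integral_sub (integrable_mul_torusChar hf _) (integrable_mul_torusChar hg _)

/-- The trigonometric polynomial with terms `cᵢ exp (2πi φᵢ·x)`. -/
noncomputable def trigPoly {ι : Type*} (S : Finset ι) (c : ι → ℂ) (φ : ι → Fin n → ℤ)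
    (x : Fin n → ℝ) : ℂ := ∑ i ∈ S, c i * torusChar (φ i) x

lemma memLp_trigPoly {ι : Type*} (S : Finset ι) (c : ι → ℂ) (φ : ι → Fin n → ℤ) (p : ENNReal) :
    MemLp (trigPoly S c φ) p (boxMeasure n) := by
  refine memLp_finsetSum S fun i _ => ?_
  refine MemLp.of_bound (continuous_const.mul (continuous_torusChar _)).aestronglyMeasurable ‖c i‖
    (ae_of_all _ fun x => (norm_mul_torusChar _ _ _).le)

lemma fCoeff_trigPoly {ι : Type*} (S : Finset ι) (c : ι → ℂ) (φ : ι → Fin n → ℤ)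
    (k : Fin n → ℤ) : fCoeff (trigPoly S c φ) k = ∑ i ∈ S, if φ i = k then c i else 0 := by
  simp only [fCoeff_eq, trigPoly, Finset.sum_mul]
  rw [integral_finsetSum]
  · refine Finset.sum_congr rfl fun i _ => ?_
    simp only [mul_assoc]
    rw [integral_const_mul, ← fCoeff_eq, fCoeff_torusChar, mul_ite, mul_one, mul_zero]
  · intro i _
    refine integrable_mul_torusChar (Integrable.const_mul ?_ _) _
    simpa using integrable_mul_torusChar (integrable_const (1 : ℂ)) (φ i)

/-- The sharp Fourier truncation to the cube of side `a`. -/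
noncomputable def cubeTrunc (a : ℕ) (f : (Fin n → ℝ) → ℂ) : (Fin n → ℝ) → ℂ :=
  trigPoly (freqCube n a) (fCoeff f) id

/-- A de la Vallée Poussin mean of `f`: it leaves the frequencies in the cube of side `a`
unchanged, and is a convolution with the normalized product of two Dirichlet kernels. -/
noncomputable def vallePoussin (a : ℕ) (f : (Fin n → ℝ) → ℂ) : (Fin n → ℝ) → ℂ :=
  trigPoly (freqCube n a ×ˢ freqCube n (2 * a))
    (fun p => ((freqCube n a).card : ℂ)⁻¹ * fCoeff f (p.1 + p.2)) fun p => p.1 + p.2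

lemma memLp_cubeTrunc (a : ℕ) (f : (Fin n → ℝ) → ℂ) (p : ENNReal) :
    MemLp (cubeTrunc a f) p (boxMeasure n) := memLp_trigPoly _ _ _ p

lemma memLp_vallePoussin (a : ℕ) (f : (Fin n → ℝ) → ℂ) (p : ENNReal) :
    MemLp (vallePoussin a f) p (boxMeasure n) := memLp_trigPoly _ _ _ p

lemma card_freqCube_pos (a : ℕ) : 0 < (freqCube n a).card := by
  rw [card_freqCube]
  positivity

lemma norm_fCoeff_sub_cubeTrunc_le {f : (Fin n → ℝ) → ℂ} (hf : Integrable f (boxMeasure n))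
    (a : ℕ) (k : Fin n → ℤ) :
    ‖fCoeff (fun x => f x - cubeTrunc a f x) k‖ ≤
      if k ∈ freqCube n a then 0 else ‖fCoeff f k‖ := by
  rw [fCoeff_sub hf ((memLp_cubeTrunc _ _ 1).integrable le_rfl), cubeTrunc, fCoeff_trigPoly]
  simp only [id, Finset.sum_ite_eq']
  split_ifs <;> simp

lemma norm_fCoeff_sub_vallePoussin_le {f : (Fin n → ℝ) → ℂ} (hf : Integrable f (boxMeasure n))
    (a : ℕ) (k : Fin n → ℤ) :
    ‖fCoeff (fun x => f x - vallePoussin a f x) k‖ ≤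
      if k ∈ freqCube n a then 0 else ‖fCoeff f k‖ := by
  classical
  set T := (freqCube n a ×ˢ freqCube n (2 * a)).filter fun p => p.1 + p.2 = k with hT
  have hpos : (0 : ℝ) < (freqCube n a).card := by exact_mod_cast card_freqCube_pos a
  have hcoeff : fCoeff (vallePoussin a f) k =
      ((T.card / (freqCube n a).card : ℝ) : ℂ) * fCoeff f k := by
    rw [vallePoussin, fCoeff_trigPoly, ← Finset.sum_filter, ← hT,
      Finset.sum_congr rfl (g := fun _ => ((freqCube n a).card : ℂ)⁻¹ * fCoeff f k)]
    · rw [Finset.sum_const, nsmul_eq_mul]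
      push_cast
      ring
    · intro p hp
      rw [(Finset.mem_filter.mp hp).2]
  have hinj : Set.InjOn Prod.fst (T : Set ((Fin n → ℤ) × (Fin n → ℤ))) := by
    intro p hp q hq hpq
    have hp' := (Finset.mem_filter.mp hp).2
    have hq' := (Finset.mem_filter.mp hq).2
    refine Prod.ext hpq ?_
    rw [← hq', hpq] at hp'
    exact add_left_cancel hp'
  have hle : T.card ≤ (freqCube n a).card := Finset.card_le_card_of_injOn Prod.fst
    (fun p hp => (Finset.mem_product.mp (Finset.mem_filter.mp hp).1).1) hinj
  rw [fCoeff_sub hf ((memLp_vallePoussin _ _ 1).integrable le_rfl), hcoeff]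
  split_ifs with hk
  · have hge : (freqCube n a).card ≤ T.card := by
      refine Finset.card_le_card_of_injOn (fun l => (l, k - l)) (fun l hl => ?_)
        fun l _ l' _ h => (Prod.ext_iff.mp h).1
      have hkl : k - l ∈ freqCube n (2 * a) := by
        rw [two_mul, sub_eq_add_neg]
        exact add_mem_freqCube hk (neg_mem_freqCube hl)
      exact Finset.mem_coe.mpr (Finset.mem_filter.mpr
        ⟨Finset.mem_product.mpr ⟨hl, hkl⟩, add_sub_cancel l k⟩)
    rw [le_antisymm hle hge, div_self hpos.ne']
    simp
  · have h0 : 0 ≤ (T.card / (freqCube n a).card : ℝ) := by positivity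
    have h1 : (T.card / (freqCube n a).card : ℝ) ≤ 1 :=
      (div_le_one hpos).mpr (by exact_mod_cast hle)
    calc _ = ‖((1 - T.card / (freqCube n a).card : ℝ) : ℂ) * fCoeff f k‖ := by
          push_cast
          ring_nf
      _ ≤ 1 * ‖fCoeff f k‖ := by
          rw [norm_mul, norm_real, Real.norm_eq_abs]
          gcongr
          rw [abs_le]
          constructor <;> linarith
      _ = _ := one_mul _

/-- The square sum of the Fourier coefficients outside the cube of side `a`. -/
noncomputable def fourierTail (a : ℕ) (f : (Fin n → ℝ) → ℂ) : ENNReal :=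
  ∑' k, if k ∈ freqCube n a then 0 else ‖fCoeff f k‖ₑ ^ 2

lemma lintegral_le_fourierTail {f h : (Fin n → ℝ) → ℂ} (hh : MemLp h 2 (boxMeasure n)) {a : ℕ}
    (hle : ∀ k, ‖fCoeff h k‖ ≤ if k ∈ freqCube n a then 0 else ‖fCoeff f k‖) :
    ∫⁻ x, ‖h x‖ₑ ^ 2 ∂boxMeasure n ≤ fourierTail a f := by
  rw [← tsum_enorm_fCoeff_sq hh]
  refine ENNReal.tsum_le_tsum fun k => ?_
  have hk := hle k
  split_ifs at hk ⊢
  · simp [norm_le_zero_iff.mp hk]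
  · gcongr
    exact enorm_le_iff_norm_le.mpr hk

lemma lintegral_dirichlet_sq (S : Finset (Fin n → ℤ)) (x : Fin n → ℝ) :
    ∫⁻ y, ‖∑ l ∈ S, torusChar l (x - y)‖ₑ ^ 2 ∂boxMeasure n = S.card := by
  have hD : (fun y => ∑ l ∈ S, torusChar l (x - y)) =
      trigPoly S (fun l => torusChar l x) fun l => -l := by
    ext y
    simp only [trigPoly, torusChar_sub_arg]
  have h := tsum_enorm_fCoeff_sq (hD ▸ memLp_trigPoly S (fun l => torusChar l x) (fun l => -l) 2)
  rw [← h, hD]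
  simp only [fCoeff_trigPoly, neg_eq_iff_eq_neg, Finset.sum_ite_eq']
  rw [← (Equiv.neg (Fin n → ℤ)).tsum_eq, tsum_eq_sum (s := S)]
  · rw [Finset.sum_congr rfl (g := fun _ => 1)]
    · simp
    · intro l hl
      have : ‖torusChar l x‖ₑ = 1 := by rw [← ofReal_norm, norm_torusChar, ENNReal.ofReal_one]
      simp [hl, this]
  · intro l hl
    simp [hl]

lemma vallePoussin_eq_integral {f : (Fin n → ℝ) → ℂ} (hf : Integrable f (boxMeasure n)) (a : ℕ)
    (x : Fin n → ℝ) :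
    vallePoussin a f x = ((freqCube n a).card : ℂ)⁻¹ * ∫ y, f y *
      ((∑ l ∈ freqCube n a, torusChar l (x - y)) *
        ∑ m ∈ freqCube n (2 * a), torusChar m (x - y)) ∂boxMeasure n := by
  have hker : ∀ y, f y * ((∑ l ∈ freqCube n a, torusChar l (x - y)) *
      ∑ m ∈ freqCube n (2 * a), torusChar m (x - y)) =
      ∑ p ∈ freqCube n a ×ˢ freqCube n (2 * a),
        torusChar (p.1 + p.2) x * (f y * torusChar (-(p.1 + p.2)) y) := fun y => by
    rw [Finset.sum_mul_sum, ← Finset.sum_product', Finset.mul_sum]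
    refine Finset.sum_congr rfl fun p _ => ?_
    rw [← torusChar_add, torusChar_sub_arg]
    ring
  simp only [hker, vallePoussin, trigPoly]
  rw [integral_finsetSum, Finset.mul_sum]
  · refine Finset.sum_congr rfl fun p _ => ?_
    rw [integral_const_mul, ← fCoeff_eq]
    ring
  · intro p _
    exact (integrable_mul_torusChar hf _).const_mul _

lemma enorm_vallePoussin_le {f : (Fin n → ℝ) → ℂ} (hf : Integrable f (boxMeasure n)) (a : ℕ)
    (x : Fin n → ℝ) :
    ‖vallePoussin a f x‖ₑ ≤ (1 + 2 ^ n) * eLpNorm f ⊤ (boxMeasure n) := by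
  have hpos := card_freqCube_pos (n := n) a
  have hA : ((freqCube n a).card : ENNReal) ≠ 0 := by exact_mod_cast hpos.ne'
  have hcont : ∀ S : Finset (Fin n → ℤ), Continuous fun y => ∑ l ∈ S, torusChar l (x - y) :=
    fun S => continuous_finsetSum _ fun l _ =>
      (continuous_torusChar l).comp (continuous_const.sub continuous_id)
  have hmul : ∀ u v : ENNReal, u * v ≤ u ^ 2 + v ^ 2 := fun u v => by
    rcases le_total u v with h | h
    · calc u * v ≤ v * v := by gcongr
        _ ≤ _ := by rw [← sq]; exact le_add_self
    · calc u * v ≤ u * u := by gcongr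
        _ ≤ _ := by rw [← sq]; exact le_self_add
  have hint : ‖∫ y, f y * ((∑ l ∈ freqCube n a, torusChar l (x - y)) *
      ∑ m ∈ freqCube n (2 * a), torusChar m (x - y)) ∂boxMeasure n‖ₑ ≤
      eLpNorm f ⊤ (boxMeasure n) * ((1 + 2 ^ n) * (freqCube n a).card) := by
    refine (enorm_integral_le_lintegral_enorm _).trans ?_
    calc _ ≤ ∫⁻ y, eLpNorm f ⊤ (boxMeasure n) *
          (‖∑ l ∈ freqCube n a, torusChar l (x - y)‖ₑ ^ 2 +
            ‖∑ m ∈ freqCube n (2 * a), torusChar m (x - y)‖ₑ ^ 2) ∂boxMeasure n := by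
          refine lintegral_mono_ae ?_
          filter_upwards [enorm_ae_le_eLpNormEssSup f (boxMeasure n)] with y hy
          rw [enorm_mul, enorm_mul, eLpNorm_exponent_top]
          exact mul_le_mul' hy (hmul _ _)
      _ = eLpNorm f ⊤ (boxMeasure n) *
            ((freqCube n a).card + (freqCube n (2 * a)).card) := by
          rw [lintegral_const_mul, lintegral_add_left, lintegral_dirichlet_sq,
            lintegral_dirichlet_sq]
          · exact (hcont _).enorm.measurable.pow_const 2
          · exact ((hcont _).enorm.measurable.pow_const 2).add
              ((hcont _).enorm.measurable.pow_const 2)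
      _ ≤ _ := by
          rw [add_mul, one_mul]
          gcongr
          exact_mod_cast card_freqCube_two_mul_le a
  rw [vallePoussin_eq_integral hf, enorm_mul]
  have hinv : ‖((freqCube n a).card : ℂ)⁻¹‖ₑ = ((freqCube n a).card : ENNReal)⁻¹ := by
    rw [enorm_inv (by exact_mod_cast hpos.ne'), ← ofReal_norm, norm_natCast,
      ENNReal.ofReal_natCast]
  rw [hinv]
  refine (mul_le_mul_right hint _).trans_eq ?_
  rw [mul_comm, mul_assoc, mul_assoc, ENNReal.mul_inv_cancel hA (ENNReal.natCast_ne_top _), mul_one,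
    mul_comm]

end TrigPoly

section Product

variable {n : ℕ}

lemma fCoeff_vallePoussin_mul_cubeTrunc (a : ℕ) (f g : (Fin n → ℝ) → ℂ) {k : Fin n → ℤ}
    (hk : k ∉ freqCube n (4 * a)) :
    fCoeff (fun x => vallePoussin a f x * cubeTrunc a g x) k = 0 := by
  have h : (fun x => vallePoussin a f x * cubeTrunc a g x) =
      trigPoly ((freqCube n a ×ˢ freqCube n (2 * a)) ×ˢ freqCube n a)
        (fun q => ((freqCube n a).card : ℂ)⁻¹ * fCoeff f (q.1.1 + q.1.2) * fCoeff g q.2)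
        fun q => q.1.1 + q.1.2 + q.2 := by
    ext x
    simp only [vallePoussin, cubeTrunc, trigPoly]
    rw [Finset.sum_mul_sum, ← Finset.sum_product']
    refine Finset.sum_congr rfl fun q _ => ?_
    rw [torusChar_add (q.1.1 + q.1.2), id]
    ring
  rw [h, fCoeff_trigPoly]
  refine Finset.sum_eq_zero fun q hq => if_neg ?_
  rintro rfl
  simp only [Finset.mem_product] at hq
  refine hk ?_
  have := add_mem_freqCube (add_mem_freqCube hq.1.1 hq.1.2) hq.2
  rwa [show a + 2 * a + a = 4 * a by ring] at this

lemma enorm_add_sq_le (u v : ℂ) : ‖u + v‖ₑ ^ 2 ≤ 4 * (‖u‖ₑ ^ 2 + ‖v‖ₑ ^ 2) := by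
  have key : ∀ p q : ENNReal, p ≤ q → (p + q) ^ 2 ≤ 4 * (p ^ 2 + q ^ 2) := fun p q h =>
    calc (p + q) ^ 2 ≤ (q + q) ^ 2 := by gcongr
      _ = 4 * q ^ 2 := by ring
      _ ≤ _ := by gcongr; exact le_add_self
  refine (pow_le_pow_left' (enorm_add_le u v) 2).trans ?_
  rcases le_total ‖u‖ₑ ‖v‖ₑ with h | h
  · exact key _ _ h
  · rw [add_comm, add_comm (‖u‖ₑ ^ 2)]
    exact key _ _ h

lemma fourierTail_mul_le {f g : (Fin n → ℝ) → ℂ} (hf : MemLp f ⊤ (boxMeasure n))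
    (hg : MemLp g ⊤ (boxMeasure n)) (a : ℕ) :
    fourierTail (4 * a) (fun x => f x * g x) ≤
      4 * (eLpNorm g ⊤ (boxMeasure n) ^ 2 * fourierTail a f +
        ((1 + 2 ^ n) * eLpNorm f ⊤ (boxMeasure n)) ^ 2 * fourierTail a g) := by
  set M := eLpNorm f ⊤ (boxMeasure n)
  set G := eLpNorm g ⊤ (boxMeasure n)
  have hfi : Integrable f (boxMeasure n) := hf.integrable le_top
  have hgi : Integrable g (boxMeasure n) := hg.integrable le_top
  have hfg : MemLp (fun x => f x * g x) ⊤ (boxMeasure n) := hg.mul hf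
  have hVP : MemLp (fun x => vallePoussin a f x * cubeTrunc a g x) ⊤ (boxMeasure n) :=
    (memLp_cubeTrunc a g ⊤).mul (memLp_vallePoussin a f ⊤)
  have hV : MemLp (fun x => f x - vallePoussin a f x) 2 (boxMeasure n) :=
    (hf.mono_exponent le_top).sub (memLp_vallePoussin a f 2)
  have hP : MemLp (fun x => g x - cubeTrunc a g x) 2 (boxMeasure n) :=
    (hg.mono_exponent le_top).sub (memLp_cubeTrunc a g 2)
  have hG : G ≠ ⊤ := hg.2.ne
  have hM : (1 + 2 ^ n) * M ≠ ⊤ := by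
    refine ENNReal.mul_ne_top ?_ hf.2.ne
    finiteness
  calc fourierTail (4 * a) (fun x => f x * g x)
      ≤ ∑' k, ‖fCoeff (fun x => f x * g x - vallePoussin a f x * cubeTrunc a g x) k‖ₑ ^ 2 := by
        refine ENNReal.tsum_le_tsum fun k => ?_
        split_ifs with hk
        · exact zero_le
        · rw [fCoeff_sub (hfg.integrable le_top) (hVP.integrable le_top),
            fCoeff_vallePoussin_mul_cubeTrunc a f g hk, sub_zero]
    _ = ∫⁻ x, ‖f x * g x - vallePoussin a f x * cubeTrunc a g x‖ₑ ^ 2 ∂boxMeasure n :=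
        tsum_enorm_fCoeff_sq ((hfg.sub hVP).mono_exponent le_top)
    _ ≤ ∫⁻ x, 4 * (G ^ 2 * ‖f x - vallePoussin a f x‖ₑ ^ 2 +
          ((1 + 2 ^ n) * M) ^ 2 * ‖g x - cubeTrunc a g x‖ₑ ^ 2) ∂boxMeasure n := by
        refine lintegral_mono_ae ?_
        filter_upwards [enorm_ae_le_eLpNormEssSup g (boxMeasure n)] with x hx
        have hsplit : f x * g x - vallePoussin a f x * cubeTrunc a g x =
            g x * (f x - vallePoussin a f x) + vallePoussin a f x * (g x - cubeTrunc a g x) := by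
          ring
        rw [hsplit]
        refine (enorm_add_sq_le _ _).trans ?_
        rw [enorm_mul, enorm_mul, mul_pow, mul_pow]
        rw [← eLpNorm_exponent_top] at hx
        gcongr
        exact enorm_vallePoussin_le hfi a x
    _ = 4 * (G ^ 2 * ∫⁻ x, ‖f x - vallePoussin a f x‖ₑ ^ 2 ∂boxMeasure n +
          ((1 + 2 ^ n) * M) ^ 2 * ∫⁻ x, ‖g x - cubeTrunc a g x‖ₑ ^ 2 ∂boxMeasure n) := by
        rw [lintegral_const_mul' _ _ (by norm_num), lintegral_add_left',
          lintegral_const_mul' _ _ (by finiteness), lintegral_const_mul' _ _ (by finiteness)]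
        exact (hV.1.enorm.pow_const 2).const_mul _
    _ ≤ _ := by
        gcongr
        · exact lintegral_le_fourierTail hV (norm_fCoeff_sub_vallePoussin_le hfi a)
        · exact lintegral_le_fourierTail hP (norm_fCoeff_sub_cubeTrunc_le hgi a)

lemma tsum_enorm_fCoeff_mul_sq_le {f g : (Fin n → ℝ) → ℂ} (hf : MemLp f ⊤ (boxMeasure n))
    (hg : MemLp g ⊤ (boxMeasure n)) :
    ∑' k, ‖fCoeff (fun x => f x * g x) k‖ₑ ^ 2 ≤
      eLpNorm g ⊤ (boxMeasure n) ^ 2 * ∑' k, ‖fCoeff f k‖ₑ ^ 2 := by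
  have hfg : MemLp (fun x => f x * g x) ⊤ (boxMeasure n) := hg.mul hf
  rw [tsum_enorm_fCoeff_sq (hfg.mono_exponent le_top),
    tsum_enorm_fCoeff_sq (hf.mono_exponent le_top),
    ← lintegral_const_mul' _ _ (ENNReal.pow_ne_top hg.2.ne)]
  refine lintegral_mono_ae ?_
  filter_upwards [enorm_ae_le_eLpNormEssSup g (boxMeasure n)] with x hx
  rw [enorm_mul, mul_pow, mul_comm, eLpNorm_exponent_top]
  gcongr

end Product

section Weights

variable {n : ℕ} {s : ℝ}

/-- The Sobolev weight `(1 + |k|²)^s`. -/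
noncomputable def sobWeight (s : ℝ) (k : Fin n → ℤ) : ℝ := (1 + ∑ i, ((k i : ℝ)) ^ 2) ^ s

/-- The increments of `a ↦ a^(2s)`. -/
noncomputable def powIncr (s : ℝ) (a : ℕ) : ℝ := ((a + 1 : ℕ) : ℝ) ^ (2 * s) - (a : ℝ) ^ (2 * s)

lemma powIncr_nonneg (hs : 0 ≤ s) (a : ℕ) : 0 ≤ powIncr s a := by
  refine sub_nonneg.mpr (Real.rpow_le_rpow (by positivity) ?_ (by positivity))
  push_cast
  linarith

lemma sum_powIncr (s : ℝ) (N : ℕ) :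
    ∑ a ∈ Finset.range N, powIncr s a = (N : ℝ) ^ (2 * s) - ((0 : ℕ) : ℝ) ^ (2 * s) :=
  Finset.sum_range_sub (fun a : ℕ => (a : ℝ) ^ (2 * s)) N

/-- The sup norm of a frequency. -/
def freqSup (k : Fin n → ℤ) : ℕ := Finset.univ.sup fun i => (k i).natAbs

lemma mem_freqCube_iff_freqSup_le {a : ℕ} {k : Fin n → ℤ} :
    k ∈ freqCube n a ↔ freqSup k ≤ a := by
  simp only [mem_freqCube, freqSup, Finset.sup_le_iff, Finset.mem_univ, true_implies]
  exact forall_congr' fun i => by rw [Int.abs_eq_natAbs, Nat.cast_le]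

lemma freqSup_sq_le (k : Fin n → ℤ) : (freqSup k : ℝ) ^ 2 ≤ ∑ i, (k i : ℝ) ^ 2 := by
  have h : freqSup k ≤ Nat.sqrt (∑ i, (k i).natAbs ^ 2) := Finset.sup_le fun i _ =>
    Nat.le_sqrt'.mpr (Finset.single_le_sum (f := fun i => (k i).natAbs ^ 2)
      (fun _ _ => Nat.zero_le _) (Finset.mem_univ i))
  have h2 : ((freqSup k ^ 2 : ℕ) : ℝ) ≤ ((∑ i, (k i).natAbs ^ 2 : ℕ) : ℝ) :=
    Nat.cast_le.mpr (Nat.le_sqrt'.mp h)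
  push_cast at h2
  simpa only [Nat.cast_natAbs, Int.cast_abs, sq_abs] using h2

lemma sum_sq_le_freqSup (k : Fin n → ℤ) : ∑ i, (k i : ℝ) ^ 2 ≤ n * (freqSup k : ℝ) ^ 2 := by
  have h : ∀ i ∈ Finset.univ, (k i : ℝ) ^ 2 ≤ (freqSup k : ℝ) ^ 2 := fun i hi => by
    have h1 : (k i).natAbs ≤ freqSup k := Finset.le_sup (f := fun i => (k i).natAbs) hi
    have h2 : ((k i).natAbs : ℝ) ≤ freqSup k := Nat.cast_le.mpr h1
    rw [Nat.cast_natAbs, Int.cast_abs] at h2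
    rw [← sq_abs]
    gcongr
  simpa using Finset.sum_le_card_nsmul _ _ _ h

lemma one_le_sobWeight (hs : 0 ≤ s) (k : Fin n → ℤ) : 1 ≤ sobWeight s k :=
  Real.one_le_rpow (le_add_of_nonneg_right (Finset.sum_nonneg fun _ _ => sq_nonneg _)) hs

lemma sum_powIncr_le_sobWeight (hs : 0 ≤ s) (k : Fin n → ℤ) :
    ∑ a ∈ Finset.range (freqSup k), powIncr s a ≤ sobWeight s k := by
  rw [sum_powIncr]
  refine (sub_le_self _ (by positivity)).trans ?_
  rw [Real.rpow_mul (by positivity), Real.rpow_two]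
  exact Real.rpow_le_rpow (by positivity) ((freqSup_sq_le k).trans (by simp)) hs

lemma sobWeight_le (hs : 0 ≤ s) (k : Fin n → ℤ) :
    sobWeight s k ≤ (16 * (n + 1)) ^ s *
      (2 + ∑ a ∈ Finset.range ((freqSup k + 3) / 4), powIncr s a) := by
  set M := (freqSup k + 3) / 4 with hM
  have hM4 : (freqSup k : ℝ) ≤ 4 * M := by
    have : freqSup k ≤ 4 * M := by omega
    exact_mod_cast this
  have h0 : ((0 : ℕ) : ℝ) ^ (2 * s) ≤ 1 := Real.rpow_le_one (by simp) (by simp) (by positivity)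
  have hmax : (max 1 (M : ℝ)) ^ (2 * s) ≤ 1 + (M : ℝ) ^ (2 * s) := by
    have hp : 0 ≤ (M : ℝ) ^ (2 * s) := by positivity
    rcases max_cases 1 (M : ℝ) with h | h <;> rw [h.1]
    · rw [Real.one_rpow]
      linarith
    · linarith
  have hbase : 1 + ∑ i, (k i : ℝ) ^ 2 ≤ 16 * (n + 1) * (max 1 (M : ℝ)) ^ 2 := by
    have h1 : (1 : ℝ) ≤ (max 1 (M : ℝ)) ^ 2 := one_le_pow₀ (le_max_left _ _)
    have h2 : (freqSup k : ℝ) ^ 2 ≤ 16 * (max 1 (M : ℝ)) ^ 2 :=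
      calc (freqSup k : ℝ) ^ 2 ≤ (4 * max 1 (M : ℝ)) ^ 2 := by
            gcongr
            exact hM4.trans (by gcongr; exact le_max_right _ _)
        _ = _ := by ring
    have h3 := (sum_sq_le_freqSup k).trans (mul_le_mul_of_nonneg_left h2 (Nat.cast_nonneg n))
    linarith
  calc sobWeight s k ≤ (16 * (n + 1) * (max 1 (M : ℝ)) ^ 2) ^ s :=
        Real.rpow_le_rpow (by positivity) hbase hs
    _ = (16 * (n + 1)) ^ s * (max 1 (M : ℝ)) ^ (2 * s) := by
        rw [Real.mul_rpow (by positivity) (by positivity), Real.rpow_mul (by positivity),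
          Real.rpow_two]
    _ ≤ _ := by
        rw [sum_powIncr]
        gcongr
        linarith

lemma tsum_ofReal_powIncr (hs : 0 ≤ s) {N : ℕ} (p : ℕ → Prop) [DecidablePred p]
    (hp : ∀ a, p a ↔ N ≤ a) :
    ∑' a, (if p a then 0 else ENNReal.ofReal (powIncr s a)) =
      ENNReal.ofReal (∑ a ∈ Finset.range N, powIncr s a) := by
  rw [ENNReal.ofReal_sum_of_nonneg fun a _ => powIncr_nonneg hs a,
    tsum_eq_sum (s := Finset.range N)]
  · refine Finset.sum_congr rfl fun a ha => if_neg ?_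
    rw [hp, not_le]
    exact Finset.mem_range.mp ha
  · intro a ha
    rw [if_pos]
    rw [hp]
    simpa using ha

/-- The squared Sobolev norm with values in `[0, ∞]`. -/
noncomputable def sobEnergy (s : ℝ) (f : (Fin n → ℝ) → ℂ) : ENNReal :=
  ∑' k, ENNReal.ofReal (sobWeight s k) * ‖fCoeff f k‖ₑ ^ 2

lemma tsum_mul_fourierTail (u : ℕ → ENNReal) (c : ℕ → ℕ) (f : (Fin n → ℝ) → ℂ) :
    ∑' a, u a * fourierTail (c a) f =
      ∑' k, (∑' a, if k ∈ freqCube n (c a) then 0 else u a) * ‖fCoeff f k‖ₑ ^ 2 := by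
  simp only [fourierTail, ← ENNReal.tsum_mul_left, ← ENNReal.tsum_mul_right]
  rw [ENNReal.tsum_comm]
  refine tsum_congr fun k => tsum_congr fun a => ?_
  split_ifs <;> simp

lemma tsum_powIncr_mul_fourierTail_le (hs : 0 ≤ s) (f : (Fin n → ℝ) → ℂ) :
    ∑' a, ENNReal.ofReal (powIncr s a) * fourierTail a f ≤ sobEnergy s f := by
  rw [tsum_mul_fourierTail _ fun a => a]
  refine ENNReal.tsum_le_tsum fun k => ?_
  rw [tsum_ofReal_powIncr hs (N := freqSup k) _ fun a => mem_freqCube_iff_freqSup_le]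
  gcongr
  exact sum_powIncr_le_sobWeight hs k

lemma sobEnergy_le (hs : 0 ≤ s) (f : (Fin n → ℝ) → ℂ) :
    sobEnergy s f ≤ ENNReal.ofReal ((16 * (n + 1)) ^ s) * (2 * ∑' k, ‖fCoeff f k‖ₑ ^ 2 +
      ∑' a, ENNReal.ofReal (powIncr s a) * fourierTail (4 * a) f) := by
  rw [tsum_mul_fourierTail _ fun a => 4 * a, ← ENNReal.tsum_mul_left, ← ENNReal.tsum_add,
    ← ENNReal.tsum_mul_left]
  refine ENNReal.tsum_le_tsum fun k => ?_
  rw [tsum_ofReal_powIncr hs (N := (freqSup k + 3) / 4) _ fun a => by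
      rw [mem_freqCube_iff_freqSup_le]; omega,
    ← add_mul, ← mul_assoc]
  gcongr
  rw [← ENNReal.ofReal_ofNat 2, ← ENNReal.ofReal_add (by simp)
    (Finset.sum_nonneg fun a _ => powIncr_nonneg hs a), ← ENNReal.ofReal_mul (by positivity)]
  exact ENNReal.ofReal_le_ofReal (sobWeight_le hs k)

lemma tsum_enorm_fCoeff_sq_le_sobEnergy (hs : 0 ≤ s) (f : (Fin n → ℝ) → ℂ) :
    ∑' k, ‖fCoeff f k‖ₑ ^ 2 ≤ sobEnergy s f :=
  ENNReal.tsum_le_tsum fun k =>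
    le_mul_of_one_le_left' (ENNReal.one_le_ofReal.mpr (one_le_sobWeight hs k))

lemma sobEnergy_mul_le (hs : 0 ≤ s) {f g : (Fin n → ℝ) → ℂ} (hf : MemLp f ⊤ (boxMeasure n))
    (hg : MemLp g ⊤ (boxMeasure n)) :
    sobEnergy s (fun x => f x * g x) ≤
      ENNReal.ofReal ((16 * (n + 1)) ^ s * (6 * (1 + 2 ^ n) ^ 2)) *
        (eLpNorm g ⊤ (boxMeasure n) ^ 2 * sobEnergy s f +
          eLpNorm f ⊤ (boxMeasure n) ^ 2 * sobEnergy s g) := by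
  set M := eLpNorm f ⊤ (boxMeasure n)
  set G := eLpNorm g ⊤ (boxMeasure n)
  have hL : (1 : ENNReal) ≤ (1 + 2 ^ n) ^ 2 := one_le_pow₀ le_self_add
  have hconst : ENNReal.ofReal ((16 * (n + 1)) ^ s * (6 * (1 + 2 ^ n) ^ 2)) =
      ENNReal.ofReal ((16 * (n + 1)) ^ s) * (6 * (1 + 2 ^ n) ^ 2) := by
    rw [ENNReal.ofReal_mul (by positivity)]
    congr 1
    rw [ENNReal.ofReal_mul (by positivity), ENNReal.ofReal_pow (by positivity),
      ENNReal.ofReal_add (by positivity) (by positivity), ENNReal.ofReal_pow (by positivity)]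
    simp
  rw [hconst, mul_assoc]
  refine (sobEnergy_le hs _).trans ?_
  gcongr
  calc _ ≤ 2 * (G ^ 2 * sobEnergy s f) + ∑' a, ENNReal.ofReal (powIncr s a) *
          (4 * (G ^ 2 * fourierTail a f + ((1 + 2 ^ n) * M) ^ 2 * fourierTail a g)) := by
        gcongr with a
        · refine (tsum_enorm_fCoeff_mul_sq_le hf hg).trans ?_
          gcongr
          exact tsum_enorm_fCoeff_sq_le_sobEnergy hs f
        · exact fourierTail_mul_le hf hg a
    _ = 2 * (G ^ 2 * sobEnergy s f) +
          (4 * G ^ 2 * ∑' a, ENNReal.ofReal (powIncr s a) * fourierTail a f +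
            4 * ((1 + 2 ^ n) * M) ^ 2 *
              ∑' a, ENNReal.ofReal (powIncr s a) * fourierTail a g) := by
        rw [← ENNReal.tsum_mul_left, ← ENNReal.tsum_mul_left, ← ENNReal.tsum_add]
        congr 2
        ext a
        ring
    _ ≤ 2 * (G ^ 2 * sobEnergy s f) +
          (4 * G ^ 2 * sobEnergy s f + 4 * ((1 + 2 ^ n) * M) ^ 2 * sobEnergy s g) := by
        gcongr <;> exact tsum_powIncr_mul_fourierTail_le hs _
    _ = 6 * 1 * (G ^ 2 * sobEnergy s f) + 4 * (1 + 2 ^ n) ^ 2 * (M ^ 2 * sobEnergy s g) := by ring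
    _ ≤ 6 * (1 + 2 ^ n) ^ 2 * (G ^ 2 * sobEnergy s f) +
          6 * (1 + 2 ^ n) ^ 2 * (M ^ 2 * sobEnergy s g) := by
        gcongr
        norm_num
    _ = _ := by ring

lemma sobEnergy_eq_tsum_ofReal (f : (Fin n → ℝ) → ℂ) : sobEnergy s f =
    ∑' k : Fin n → ℤ, ENNReal.ofReal ((1 + ∑ i, ((k i : ℝ)) ^ 2) ^ s * ‖fCoeff f k‖ ^ 2) := by
  refine tsum_congr fun k => ?_
  rw [ENNReal.ofReal_mul (by positivity), ENNReal.ofReal_pow (norm_nonneg _), ofReal_norm]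
  rfl

lemma memHs_iff (f : (Fin n → ℝ) → ℂ) : MemHs s f ↔ sobEnergy s f ≠ ⊤ := by
  rw [sobEnergy_eq_tsum_ofReal]
  refine ⟨fun h => h.tsum_ofReal_ne_top, fun h => ?_⟩
  refine (ENNReal.summable_toReal h).congr fun k => ?_
  rw [ENNReal.toReal_ofReal (by positivity)]

lemma hSobSq_eq {f : (Fin n → ℝ) → ℂ} (hf : MemHs s f) : hSobSq s f = (sobEnergy s f).toReal := by
  rw [sobEnergy_eq_tsum_ofReal, ← ENNReal.ofReal_tsum_of_nonneg (fun k => by positivity) hf,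
    ENNReal.toReal_ofReal (tsum_nonneg fun k => by positivity)]
  rfl

end Weights

/-- The product estimate `‖fg‖_{Hˢ} ≤ C(‖f‖_{Hˢ}‖g‖_{L^∞} + ‖f‖_{L^∞}‖g‖_{Hˢ})` on the torus. -/
theorem product_sobolev_estimate (n : ℕ) (s : ℝ) (hs : 0 ≤ s) :
    ∃ C > 0, ∀ f g : (Fin n → ℝ) → ℂ,
      AEStronglyMeasurable f (volume.restrict (unitBox n)) →
      AEStronglyMeasurable g (volume.restrict (unitBox n)) →
      MemHs s f → MemHs s g →
      eLpNorm f ⊤ (volume.restrict (unitBox n)) ≠ ⊤ →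
      eLpNorm g ⊤ (volume.restrict (unitBox n)) ≠ ⊤ →
      MemHs s (fun x => f x * g x) ∧
      hSob s (fun x => f x * g x) ≤
        C * (hSob s f * (eLpNorm g ⊤ (volume.restrict (unitBox n))).toReal
              + (eLpNorm f ⊤ (volume.restrict (unitBox n))).toReal * hSob s g) := by
  set K : ℝ := (16 * (n + 1)) ^ s * (6 * (1 + 2 ^ n) ^ 2) with hK
  have hKpos : 0 < K := by positivity
  refine ⟨Real.sqrt K, Real.sqrt_pos.mpr hKpos, fun f g hfm hgm hf hg hf' hg' => ?_⟩
  have hle := sobEnergy_mul_le hs (f := f) (g := g) ⟨hfm, hf'.lt_top⟩ ⟨hgm, hg'.lt_top⟩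
  rw [← hK] at hle
  have hEf := (memHs_iff f).mp hf
  have hEg := (memHs_iff g).mp hg
  have hfin : ENNReal.ofReal K *
      (eLpNorm g ⊤ (boxMeasure n) ^ 2 * sobEnergy s f +
        eLpNorm f ⊤ (boxMeasure n) ^ 2 * sobEnergy s g) ≠ ⊤ := by
    finiteness
  have hmem : MemHs s (fun x => f x * g x) := (memHs_iff _).mpr (ne_top_of_le_ne_top hfin hle)
  refine ⟨hmem, ?_⟩
  have hreal := ENNReal.toReal_mono hfin hle
  rw [ENNReal.toReal_mul, ENNReal.toReal_add (by finiteness) (by finiteness), ENNReal.toReal_mul,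
    ENNReal.toReal_mul, ENNReal.toReal_pow, ENNReal.toReal_pow, ENNReal.toReal_ofReal hKpos.le,
    ← hSobSq_eq hmem, ← hSobSq_eq hf, ← hSobSq_eq hg] at hreal
  have hnonneg : ∀ u : (Fin n → ℝ) → ℂ, 0 ≤ hSobSq s u := fun u =>
    tsum_nonneg fun k => by positivity
  have hsq : ∀ u : (Fin n → ℝ) → ℂ, hSob s u ^ 2 = hSobSq s u := fun u =>
    Real.sq_sqrt (hnonneg u)
  have hpos : ∀ u : (Fin n → ℝ) → ℂ, 0 ≤ hSob s u := fun u => Real.sqrt_nonneg _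
  refine Real.sqrt_le_iff.mpr ⟨by have := hpos f; have := hpos g; positivity, hreal.trans ?_⟩
  rw [mul_pow, Real.sq_sqrt hKpos.le, ← hsq f, ← hsq g]
  gcongr
  have hcross : 0 ≤ hSob s f * (eLpNorm g ⊤ (boxMeasure n)).toReal *
      ((eLpNorm f ⊤ (boxMeasure n)).toReal * hSob s g) := by
    have := hpos f
    have := hpos g
    positivity
  linear_combination 2 * hcross
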